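/- Let N ≥ 3, 2* = 2N/(N−2), and let (u_k)_{k∈ℕ} be a sequence in C_c^∞(ℝ^N) with sup_k ∫_{ℝ^N}(|∇u_k|² + u_k²) dx < ∞. Let ν ∈ ℕ and for each n = 1, …, ν let (j_k^{(n)}) be a sequence in ℕ with j_k^{(n)} → ∞, let (y_k^{(n)}) be a sequence in ℝ^N, and let w^{(n)} be a C¹ function with w^{(n)} ∈ L^{2*}(ℝ^N) and ∇w^{(n)} ∈ L²(ℝ^N; ℝ^N). Assume that for all n ≠ n' the pairs (j_k^{(n)}, y_k^{(n)}) and (j_k^{(n')}, y_k^{(n')}) are asymptotically decoupled, and that for each n and every φ ∈ C_c^∞(ℝ^N), ∫ ∇[2^{−j_k^{(n)}(N−2)/2} u_k(y_k^{(n)} + 2^{−j_k^{(n)}} ξ)] · ∇φ(ξ) dξ → ∫ ∇w^{(n)} · ∇φ dξ. Then Σ_{n=1}^{ν} ∫_{ℝ^N} |∇w^{(n)}|² dξ ≤ liminf_k ∫_{ℝ^N} |∇u_k|² dx. -/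

import Mathlib

open MeasureTheory Filter Topology
open scoped RealInnerProductSpace

noncomputable section

section Density

variable {E : Type*} [NormedAddCommGroup E] [InnerProductSpace ℝ E] [FiniteDimensional ℝ E]
  [MeasurableSpace E] [BorelSpace E]

open Convolution in
/-- Mollification: a compactly supported `C¹` function is approximated by test functions,
with derivatives converging in `L²`. -/
lemma exists_contDiff_integral_norm_fderiv_sub_sq_le_of_hasCompactSupport {g : E → ℝ}
    (hg : ContDiff ℝ 1 g) (hgc : HasCompactSupport g) {ε : ℝ} (hε : 0 < ε) :
    ∃ φ : E → ℝ, ContDiff ℝ (⊤ : ℕ∞) φ ∧ HasCompactSupport φ ∧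
      ∫ x, ‖fderiv ℝ g x - fderiv ℝ φ x‖ ^ 2 ≤ ε := by
  obtain ⟨R, hR⟩ := hgc.isCompact.isBounded.subset_closedBall (0 : E)
  set V := volume.real (Metric.closedBall (0 : E) (R + 1)) with hV
  have hV0 : 0 ≤ V := measureReal_nonneg
  obtain ⟨η, hη, hηV⟩ : ∃ η : ℝ, 0 < η ∧ η ^ 2 * V ≤ ε := by
    refine ⟨√(ε / (V + 1)), by positivity, ?_⟩
    rw [Real.sq_sqrt (by positivity), div_mul_eq_mul_div, div_le_iff₀ (by positivity)]
    nlinarith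
  have hdc : Continuous (fderiv ℝ g) := hg.continuous_fderiv one_ne_zero
  obtain ⟨δ, hδ, hδu⟩ := Metric.uniformContinuous_iff.1
    ((hgc.fderiv ℝ).uniformContinuous_of_continuous hdc) η hη
  let ρ : ContDiffBump (0 : E) :=
    ⟨min δ 1 / 2, min δ 1, by positivity, half_lt_self (by positivity)⟩
  set φ : E → ℝ := ρ.normed volume ⋆[ContinuousLinearMap.lsmul ℝ ℝ, volume] g with hφ
  have hφs : ContDiff ℝ (⊤ : ℕ∞) φ :=
    ρ.hasCompactSupport_normed.contDiff_convolution_left _ ρ.contDiff_normed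
      hg.continuous.locallyIntegrable
  have hφc : HasCompactSupport φ := ρ.hasCompactSupport_normed.convolution _ hgc
  have hφ' (x : E) : fderiv ℝ φ x =
      (ρ.normed volume ⋆[ContinuousLinearMap.lsmul ℝ ℝ, volume] fderiv ℝ g) x :=
    (hgc.hasFDerivAt_convolution_right (ContinuousLinearMap.lsmul ℝ ℝ)
      ρ.continuous_normed.locallyIntegrable hg x).fderiv
  have hclose (x : E) : ‖fderiv ℝ g x - fderiv ℝ φ x‖ ≤ η := by
    rw [← dist_eq_norm, dist_comm, hφ' x]
    exact ρ.dist_normed_convolution_le hdc.aestronglyMeasurable fun z hz ↦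
      (hδu (lt_of_lt_of_le hz (min_le_left _ _))).le
  have hg0 (x : E) (hx : x ∉ Metric.closedBall (0 : E) (R + 1)) : fderiv ℝ g x = 0 := by
    by_contra h
    refine hx (Metric.closedBall_subset_closedBall (by linarith) (hR ?_))
    exact support_fderiv_subset ℝ h
  have hφ0 (x : E) (hx : x ∉ Metric.closedBall (0 : E) (R + 1)) : fderiv ℝ φ x = 0 := by
    by_contra h
    refine hx ?_
    have h1 : x ∈ tsupport φ := support_fderiv_subset ℝ h
    have h2 : tsupport φ ⊆ Metric.closedBall (0 : E) (R + 1) := by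
      refine closure_minimal (fun z hz ↦ ?_) Metric.isClosed_closedBall
      obtain ⟨a, ha, b, hb, rfl⟩ := support_convolution_subset _ hz
      rw [ρ.support_normed_eq] at ha
      have ha' := mem_ball_zero_iff.1 ha
      have hb' := mem_closedBall_zero_iff.1 (hR (subset_tsupport _ hb))
      have := min_le_right δ 1
      refine mem_closedBall_zero_iff.2 ((norm_add_le a b).trans ?_)
      change ‖a‖ < min δ 1 at ha'
      linarith
    exact h2 h1
  refine ⟨φ, hφs, hφc, ?_⟩
  calc ∫ x, ‖fderiv ℝ g x - fderiv ℝ φ x‖ ^ 2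
      = ∫ x in Metric.closedBall (0 : E) (R + 1), ‖fderiv ℝ g x - fderiv ℝ φ x‖ ^ 2 := by
        refine (setIntegral_eq_integral_of_forall_compl_eq_zero fun x hx ↦ ?_).symm
        simp [hg0 x hx, hφ0 x hx]
    _ ≤ ‖∫ x in Metric.closedBall (0 : E) (R + 1), ‖fderiv ℝ g x - fderiv ℝ φ x‖ ^ 2‖ :=
        Real.le_norm_self _
    _ ≤ η ^ 2 * V := by
        refine norm_setIntegral_le_of_norm_le_const measure_closedBall_lt_top fun x _ ↦ ?_
        rw [norm_pow, norm_norm]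
        gcongr
        exact hclose x
    _ ≤ ε := hηV

/-- Truncation: a `C¹` function in `L^{2*}` with derivative in `L²` is approximated by compactly
supported `C¹` functions, with derivatives converging in `L²`. -/
lemma exists_contDiff_one_integral_norm_fderiv_sub_sq_le {w : E → ℝ} {d : ℝ}
    (hdim : d = Module.finrank ℝ E) (hd : 2 < d)
    (hw : ContDiff ℝ 1 w) (hwLp : Integrable fun x ↦ |w x| ^ (2 * d / (d - 2)))
    (hwd : Integrable fun x ↦ ‖fderiv ℝ w x‖ ^ 2) {ε : ℝ} (hε : 0 < ε) :
    ∃ g : E → ℝ, ContDiff ℝ 1 g ∧ HasCompactSupport g ∧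
      ∫ x, ‖fderiv ℝ w x - fderiv ℝ g x‖ ^ 2 ≤ ε := by
  let f : ContDiffBump (0 : E) := ⟨1, 2, one_pos, one_lt_two⟩
  have hfd : Continuous (fderiv ℝ f) := (f.contDiff (n := 1)).continuous_fderiv one_ne_zero
  obtain ⟨C, hC⟩ := (f.hasCompactSupport.fderiv ℝ).exists_bound_of_continuous hfd
  have hC0 : 0 ≤ C := (norm_nonneg _).trans (hC 0)
  set p : ℝ := d / (d - 2) with hp
  set q : ℝ := d / 2 with hq
  have hd2 : 0 < d - 2 := by linarith
  have hpq : p.HolderConjugate q := by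
    rw [Real.holderConjugate_iff]
    refine ⟨?_, ?_⟩
    · rw [hp, lt_div_iff₀ hd2]; linarith
    · rw [hp, hq]; field_simp; ring
  have hp1 := hpq.lt
  have hq0 := hpq.symm.pos
  have hq1 := hpq.symm.lt
  set V : ℝ := volume.real (Metric.closedBall (0 : E) 1) with hV
  have hV0 : 0 ≤ V := measureReal_nonneg
  obtain ⟨t, ht, htε⟩ : ∃ t : ℝ, 0 < t ∧ t⁻¹ ^ q * (2 * (2 * C) ^ d * V) ≤ ε / 2 := by
    have h1 : Tendsto (fun t : ℝ ↦ t⁻¹ ^ q * (2 * (2 * C) ^ d * V)) atTop (𝓝 (0 * (2 * (2 * C) ^ d * V))) := by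
      refine Tendsto.mul_const _ ?_
      refine (tendsto_rpow_neg_atTop hq0).congr' ?_
      filter_upwards [eventually_gt_atTop 0] with t ht
      rw [Real.inv_rpow ht.le, Real.rpow_neg ht.le]
    rw [zero_mul] at h1
    obtain ⟨t, h2, h3⟩ :=
      ((eventually_gt_atTop (0 : ℝ)).and (h1.eventually_le_const (half_pos hε))).exists
    exact ⟨t, h2, h3⟩
  set H : E → ℝ := fun x ↦ 2 * ‖fderiv ℝ w x‖ ^ 2 + 2 * t ^ p * |w x| ^ (2 * d / (d - 2)) with hH
  have hHi : Integrable H := (hwd.const_mul 2).add (hwLp.const_mul _)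
  have hH0 (x) : 0 ≤ H x := by positivity
  obtain ⟨n, hn1, hnε⟩ : ∃ n : ℕ, 1 ≤ n ∧ ∫ x in (Metric.ball (0 : E) n)ᶜ, H x ≤ ε / 2 := by
    have h1 := tendsto_setIntegral_of_antitone (μ := volume) (f := H)
      (s := fun n : ℕ ↦ (Metric.ball (0 : E) n)ᶜ) (fun n ↦ Metric.isOpen_ball.measurableSet.compl)
      (fun a b hab ↦ Set.compl_subset_compl.2 (Metric.ball_subset_ball (by exact_mod_cast hab)))
      ⟨0, hHi.integrableOn⟩
    have h2 : ⋂ n : ℕ, (Metric.ball (0 : E) n)ᶜ = ∅ := by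
      rw [← Set.compl_iUnion, Metric.iUnion_ball_nat, Set.compl_univ]
    rw [h2, setIntegral_empty] at h1
    obtain ⟨n, h3, h4⟩ :=
      ((eventually_ge_atTop 1).and (h1.eventually_le_const (half_pos hε))).exists
    exact ⟨n, h3, h4⟩
  set R : ℝ := (n : ℝ) with hR
  have hRpos : 0 < R := by rw [hR]; exact_mod_cast hn1
  set χ : E → ℝ := fun x ↦ f (R⁻¹ • x) with hχ
  have hχs : ContDiff ℝ 1 χ := f.contDiff.comp (contDiff_const_smul _)
  have hχc : HasCompactSupport χ := f.hasCompactSupport.comp_smul (inv_ne_zero hRpos.ne')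
  have hχ' (x : E) : fderiv ℝ χ x = R⁻¹ • fderiv ℝ f (R⁻¹ • x) := by
    exact fderiv_comp_smul _
  have hχb (x : E) : ‖fderiv ℝ χ x‖ ≤ R⁻¹ * C := by
    rw [hχ', norm_smul, Real.norm_of_nonneg (by positivity)]
    gcongr
    exact hC _
  have hχ1 (x : E) (hx : x ∈ Metric.ball (0 : E) R) : χ =ᶠ[𝓝 x] 1 := by
    filter_upwards [Metric.isOpen_ball.mem_nhds hx] with z hz
    refine f.one_of_mem_closedBall ?_
    rw [mem_closedBall_zero_iff, norm_smul, Real.norm_of_nonneg (by positivity)]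
    change R⁻¹ * ‖z‖ ≤ 1
    rw [inv_mul_le_iff₀ hRpos]
    linarith [mem_ball_zero_iff.1 hz]
  have hχ2 (x : E) (hx : x ∉ Metric.closedBall (0 : E) (2 * R)) : fderiv ℝ χ x = 0 := by
    rw [hχ']
    have : R⁻¹ • x ∉ tsupport f := by
      rw [f.tsupport_eq, mem_closedBall_zero_iff, norm_smul, Real.norm_of_nonneg (by positivity)]
      change ¬ (R⁻¹ * ‖x‖ ≤ 2)
      rw [inv_mul_le_iff₀ hRpos, mul_comm]
      simpa using hx
    rw [fderiv_of_notMem_tsupport (𝕜 := ℝ) this, smul_zero]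
  have hgs : ContDiff ℝ 1 (fun x ↦ χ x * w x) := hχs.mul hw
  have hg' (x : E) : fderiv ℝ (fun x ↦ χ x * w x) x = χ x • fderiv ℝ w x + w x • fderiv ℝ χ x :=
    fderiv_fun_mul (hχs.differentiable one_ne_zero x) (hw.differentiable one_ne_zero x)
  refine ⟨fun x ↦ χ x * w x, hgs, hχc.mul_right, ?_⟩
  set K : ℝ := 2 * (t⁻¹ * (R⁻¹ * C) ^ 2) ^ q with hK
  have hK0 : 0 ≤ K := by positivity
  have hyoung (a b : ℝ) (hb : 0 ≤ b) (hbC : b ≤ R⁻¹ * C) :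
      2 * (a ^ 2 * b ^ 2) ≤ 2 * t ^ p * |a| ^ (2 * d / (d - 2)) + K := by
    have h1 := Real.young_inequality_of_nonneg (a := t * a ^ 2) (b := t⁻¹ * b ^ 2)
      (by positivity) (by positivity) hpq
    have h2 : t * a ^ 2 * (t⁻¹ * b ^ 2) = a ^ 2 * b ^ 2 := by field_simp
    have h3 : (t * a ^ 2) ^ p = t ^ p * |a| ^ (2 * d / (d - 2)) := by
      rw [Real.mul_rpow ht.le (by positivity), ← sq_abs, ← Real.rpow_natCast,
        ← Real.rpow_mul (abs_nonneg a)]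
      congr 2
      rw [hp]; push_cast; ring
    have h4 : (t * a ^ 2) ^ p / p ≤ (t * a ^ 2) ^ p := div_le_self (by positivity) hp1.le
    have h5 : (t⁻¹ * b ^ 2) ^ q / q ≤ (t⁻¹ * b ^ 2) ^ q := div_le_self (by positivity) hq1.le
    have h6 : (t⁻¹ * b ^ 2) ^ q ≤ (t⁻¹ * (R⁻¹ * C) ^ 2) ^ q := by gcongr
    rw [hK]
    rw [h2] at h1
    rw [h3] at h1 h4
    linarith
  have hpt (x : E) : ‖fderiv ℝ w x - fderiv ℝ (fun x ↦ χ x * w x) x‖ ^ 2 ≤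
      (Metric.ball (0 : E) R)ᶜ.indicator H x +
        (Metric.closedBall (0 : E) (2 * R)).indicator (fun _ ↦ K) x := by
    have hi1 : 0 ≤ (Metric.closedBall (0 : E) (2 * R)).indicator (fun _ ↦ K) x :=
      Set.indicator_nonneg (fun _ _ ↦ hK0) x
    by_cases hx : x ∈ Metric.ball (0 : E) R
    · have h1 : fderiv ℝ χ x = 0 := by rw [(hχ1 x hx).fderiv_eq]; exact fderiv_const_apply _
      have h2 : χ x = 1 := (hχ1 x hx).eq_of_nhds
      rw [hg', h1, h2, Set.indicator_of_notMem (by simpa using hx)]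
      simpa using hi1
    · rw [hg', Set.indicator_of_mem (by simpa using hx)]
      have h1 : 0 ≤ χ x := f.nonneg
      have h2 : χ x ≤ 1 := f.le_one
      have h3 : ‖fderiv ℝ w x - (χ x • fderiv ℝ w x + w x • fderiv ℝ χ x)‖ ≤
          ‖fderiv ℝ w x‖ + |w x| * ‖fderiv ℝ χ x‖ := by
        have h4 : fderiv ℝ w x - (χ x • fderiv ℝ w x + w x • fderiv ℝ χ x) =
            (1 - χ x) • fderiv ℝ w x - w x • fderiv ℝ χ x := by module
        rw [h4]
        refine (norm_sub_le _ _).trans ?_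
        rw [norm_smul, norm_smul, Real.norm_of_nonneg (by linarith), Real.norm_eq_abs]
        nlinarith [norm_nonneg (fderiv ℝ w x)]
      have h5 : ‖fderiv ℝ w x - (χ x • fderiv ℝ w x + w x • fderiv ℝ χ x)‖ ^ 2 ≤
          2 * ‖fderiv ℝ w x‖ ^ 2 + 2 * ((w x) ^ 2 * ‖fderiv ℝ χ x‖ ^ 2) := by
        refine (pow_le_pow_left₀ (norm_nonneg _) h3 2).trans ?_
        rw [← sq_abs (w x)]
        nlinarith [sq_nonneg (‖fderiv ℝ w x‖ - |w x| * ‖fderiv ℝ χ x‖)]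
      have h6 := hyoung (w x) _ (norm_nonneg (fderiv ℝ χ x)) (hχb x)
      by_cases hx2 : x ∈ Metric.closedBall (0 : E) (2 * R)
      · rw [Set.indicator_of_mem hx2]
        simp only [hH]
        linarith
      · rw [Set.indicator_of_notMem hx2]
        rw [hχ2 x hx2] at h5 ⊢
        have : 0 ≤ t ^ p * |w x| ^ (2 * d / (d - 2)) := by positivity
        simp only [hH]
        simp only [norm_zero] at h5
        linarith
  have hm1 : MeasurableSet (Metric.ball (0 : E) R)ᶜ := Metric.isOpen_ball.measurableSet.compl
  have hm2 : MeasurableSet (Metric.closedBall (0 : E) (2 * R)) :=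
    Metric.isClosed_closedBall.measurableSet
  have hI2 : Integrable ((Metric.closedBall (0 : E) (2 * R)).indicator (fun _ ↦ K)) :=
    (integrable_indicator_iff hm2).2 (integrableOn_const measure_closedBall_lt_top.ne)
  have hKV : (2 * R) ^ Module.finrank ℝ E * V * K ≤ ε / 2 := by
    refine le_of_eq_of_le ?_ htε
    have h1 : (t⁻¹ * (R⁻¹ * C) ^ 2) ^ q = t⁻¹ ^ q * (R⁻¹ * C) ^ d := by
      rw [Real.mul_rpow (by positivity) (by positivity), ← Real.rpow_natCast (R⁻¹ * C) 2,
        ← Real.rpow_mul (by positivity)]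
      congr 2
      rw [hq]; push_cast; ring
    have h2 : (2 * R) ^ d * (R⁻¹ * C) ^ d = (2 * C) ^ d := by
      rw [← Real.mul_rpow (by positivity) (by positivity)]
      congr 1
      field_simp
    rw [hK, h1, ← Real.rpow_natCast, ← hdim, ← h2]
    ring
  calc ∫ x, ‖fderiv ℝ w x - fderiv ℝ (fun x ↦ χ x * w x) x‖ ^ 2
      ≤ ∫ x, ((Metric.ball (0 : E) R)ᶜ.indicator H x +
        (Metric.closedBall (0 : E) (2 * R)).indicator (fun _ ↦ K) x) :=
        integral_mono_of_nonneg (ae_of_all _ fun x ↦ by positivity)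
          ((hHi.indicator hm1).add hI2) (ae_of_all _ hpt)
    _ = (∫ x in (Metric.ball (0 : E) R)ᶜ, H x) + (2 * R) ^ Module.finrank ℝ E * V * K := by
        rw [integral_add (hHi.indicator hm1) hI2, integral_indicator hm1, integral_indicator hm2,
          setIntegral_const, Measure.addHaar_real_closedBall' _ _ (by positivity), smul_eq_mul]
    _ ≤ ε := by linarith

end Density

section Gradient

variable {E : Type*} [NormedAddCommGroup E] [InnerProductSpace ℝ E] [FiniteDimensional ℝ E]

lemma norm_gradient_sub_gradient (f g : E → ℝ) (x : E) :
    ‖gradient f x - gradient g x‖ = ‖fderiv ℝ f x - fderiv ℝ g x‖ := by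
  rw [gradient, gradient, ← map_sub, LinearIsometryEquiv.norm_map]

lemma norm_gradient (f : E → ℝ) (x : E) : ‖gradient f x‖ = ‖fderiv ℝ f x‖ := by
  rw [gradient, LinearIsometryEquiv.norm_map]

lemma ContDiff.continuous_gradient {f : E → ℝ} (hf : ContDiff ℝ 1 f) :
    Continuous (gradient f) :=
  (InnerProductSpace.toDual ℝ E).symm.continuous.comp (hf.continuous_fderiv one_ne_zero)

lemma HasCompactSupport.gradient {f : E → ℝ} (hf : HasCompactSupport f) :
    HasCompactSupport (gradient f) :=
  (hf.fderiv ℝ).comp_left (g := (InnerProductSpace.toDual ℝ E).symm) (map_zero _)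

lemma gradient_const_mul_comp_add_smul {f : E → ℝ} (hf : Differentiable ℝ f) (c s : ℝ) (y ξ : E) :
    gradient (fun z ↦ c * f (y + s • z)) ξ = (c * s) • gradient f (y + s • ξ) := by
  have h1 : HasFDerivAt (fun z : E ↦ y + s • z) (s • ContinuousLinearMap.id ℝ E) ξ :=
    ((hasFDerivAt_id ξ).const_smul s).const_add y
  have h2 := ((hf (y + s • ξ)).hasFDerivAt.comp ξ h1).const_mul c
  have h3 : fderiv ℝ (fun z ↦ c * f (y + s • z)) ξ = (c * s) • fderiv ℝ f (y + s • ξ) := by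
    refine h2.fderiv.trans ?_
    ext v
    simp [mul_assoc]
  rw [gradient, gradient, h3, map_smulₛₗ]
  simp

lemma integral_norm_sub_sq_le {X F : Type*} [MeasurableSpace X] {μ : Measure X}
    [NormedAddCommGroup F] {f g h : X → F} (hf : MemLp f 2 μ) (hg : MemLp g 2 μ)
    (hh : MemLp h 2 μ) :
    ∫ x, ‖f x - h x‖ ^ 2 ∂μ ≤ 2 * (∫ x, ‖f x - g x‖ ^ 2 ∂μ) + 2 * ∫ x, ‖g x - h x‖ ^ 2 ∂μ := by
  have h1 := ((hf.sub hg).integrable_norm_pow two_ne_zero).const_mul 2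
  have h2 := ((hg.sub hh).integrable_norm_pow two_ne_zero).const_mul 2
  simp only [Pi.sub_apply] at h1 h2
  rw [← integral_const_mul, ← integral_const_mul, ← integral_add h1 h2]
  refine integral_mono ((hf.sub hh).integrable_norm_pow two_ne_zero) (h1.add h2) fun x ↦ ?_
  have h3 := pow_le_pow_left₀ (norm_nonneg _)
    (norm_sub_le_norm_sub_add_norm_sub (f x) (g x) (h x)) 2
  change ‖f x - h x‖ ^ 2 ≤ 2 * ‖f x - g x‖ ^ 2 + 2 * ‖g x - h x‖ ^ 2
  nlinarith [sq_nonneg (‖f x - g x‖ - ‖g x - h x‖)]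

variable [MeasurableSpace E] [BorelSpace E]

/-- A `C¹` function in `L^{2*}` with gradient in `L²` is approximated by test functions in the
homogeneous Sobolev seminorm. -/
lemma exists_contDiff_integral_norm_gradient_sub_sq_le {w : E → ℝ} {d : ℝ}
    (hdim : d = Module.finrank ℝ E) (hd : 2 < d)
    (hw : ContDiff ℝ 1 w) (hwLp : Integrable fun x ↦ |w x| ^ (2 * d / (d - 2)))
    (hwd : Integrable fun x ↦ ‖gradient w x‖ ^ 2) {ε : ℝ} (hε : 0 < ε) :
    ∃ φ : E → ℝ, ContDiff ℝ (⊤ : ℕ∞) φ ∧ HasCompactSupport φ ∧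
      ∫ x, ‖gradient w x - gradient φ x‖ ^ 2 ≤ ε := by
  obtain ⟨g, hg, hgc, hgε⟩ := exists_contDiff_one_integral_norm_fderiv_sub_sq_le hdim hd hw hwLp
    (by simpa only [norm_gradient] using hwd) (ε := ε / 4) (by positivity)
  obtain ⟨φ, hφ, hφc, hφε⟩ := exists_contDiff_integral_norm_fderiv_sub_sq_le_of_hasCompactSupport
    hg hgc (ε := ε / 4) (by positivity)
  simp only [← norm_gradient_sub_gradient] at hgε hφε
  refine ⟨φ, hφ, hφc, ?_⟩
  have hw2 : MemLp (gradient w) 2 :=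
    (memLp_two_iff_integrable_sq_norm hw.continuous_gradient.aestronglyMeasurable).2 hwd
  have hg2 : MemLp (gradient g) 2 :=
    hg.continuous_gradient.memLp_of_hasCompactSupport hgc.gradient
  have hφ2 : MemLp (gradient φ) 2 :=
    (hφ.of_le (by simp)).continuous_gradient.memLp_of_hasCompactSupport hφc.gradient
  have := integral_norm_sub_sq_le hw2 hg2 hφ2
  linarith

end Gradient

section Bubble

variable {E : Type*} [NormedAddCommGroup E] [InnerProductSpace ℝ E]

/-- The `L²`-isometric rescaling of the vector field `F` to scale `s⁻¹` around `y`. -/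
def bubble (s : ℝ) (y : E) (F : E → E) (x : E) : E :=
  √(s ^ Module.finrank ℝ E) • F (s • (x - y))

lemma Continuous.bubble {F : E → E} (hF : Continuous F) (s : ℝ) (y : E) :
    Continuous (bubble s y F) := by
  unfold _root_.bubble
  fun_prop

lemma HasCompactSupport.bubble {F : E → E} (hF : HasCompactSupport F) {s : ℝ} (hs : s ≠ 0)
    (y : E) : HasCompactSupport (bubble s y F) := by
  have h : HasCompactSupport fun x ↦ F (s • (x - y)) :=
    (hF.comp_smul hs).comp_homeomorph (Homeomorph.subRight y)
  exact h.comp_left (g := fun v ↦ √(s ^ Module.finrank ℝ E) • v) (smul_zero _)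

variable [FiniteDimensional ℝ E] [MeasurableSpace E] [BorelSpace E]

lemma integral_comp_smul_sub (f : E → ℝ) {s : ℝ} (hs : 0 < s) (y : E) :
    ∫ x, f (s • (x - y)) = (s ^ Module.finrank ℝ E)⁻¹ * ∫ x, f x := by
  rw [integral_sub_right_eq_self (fun x ↦ f (s • x)) y, Measure.integral_comp_smul,
    abs_of_nonneg (by positivity), smul_eq_mul]

lemma integral_inner_bubble (G F : E → E) {s : ℝ} (hs : 0 < s) (y : E) :
    ∫ x, ⟪G x, bubble s y F x⟫ =
      (√(s ^ Module.finrank ℝ E))⁻¹ * ∫ ξ, ⟪G (y + s⁻¹ • ξ), F ξ⟫ := by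
  have h := integral_comp_smul_sub (fun ξ ↦ ⟪G (y + s⁻¹ • ξ), F ξ⟫) hs y
  have h1 (x : E) : y + s⁻¹ • s • (x - y) = x := by
    rw [inv_smul_smul₀ hs.ne', add_sub_cancel]
  simp only [h1] at h
  simp only [bubble, inner_smul_right, integral_const_mul, h]
  rw [← mul_assoc]
  congr 1
  rw [← div_eq_mul_inv, Real.sqrt_div_self]

lemma integral_norm_bubble_sq (F : E → E) {s : ℝ} (hs : 0 < s) (y : E) :
    ∫ x, ‖bubble s y F x‖ ^ 2 = ∫ ξ, ‖F ξ‖ ^ 2 := by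
  have h2 : 0 < s ^ Module.finrank ℝ E := by positivity
  simp only [bubble, norm_smul, mul_pow, Real.norm_eq_abs, sq_abs, Real.sq_sqrt h2.le]
  rw [integral_const_mul, integral_comp_smul_sub (fun ξ ↦ ‖F ξ‖ ^ 2) hs y,
    mul_inv_cancel_left₀ h2.ne']

/-- The pairing of two bubbles decays with the ratio of the scales. -/
lemma abs_integral_inner_bubble_le {F G : E → E} {A B r : ℝ} (hr : 0 ≤ r)
    (hF : ∀ x, ‖F x‖ ≤ A) (hG : ∀ x, ‖G x‖ ≤ B)
    (hFr : ∀ x, r < ‖x‖ → F x = 0) {s t : ℝ} (hs : 0 < s) (ht : 0 < t) (y z : E) :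
    |∫ x, ⟪bubble s y F x, bubble t z G x⟫| ≤
      A * B * (r ^ Module.finrank ℝ E * volume.real (Metric.closedBall (0 : E) 1)) *
        √((t / s) ^ Module.finrank ℝ E) := by
  have hA : 0 ≤ A := (norm_nonneg _).trans (hF 0)
  have hB : 0 ≤ B := (norm_nonneg _).trans (hG 0)
  have h0 (x : E) (hx : x ∉ Metric.closedBall y (r / s)) : bubble s y F x = 0 := by
    rw [bubble, hFr, smul_zero]
    rw [mem_closedBall_iff_norm, not_le, div_lt_iff₀ hs] at hx
    rwa [norm_smul, Real.norm_of_nonneg hs.le, mul_comm]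
  rw [← setIntegral_eq_integral_of_forall_compl_eq_zero (s := Metric.closedBall y (r / s))
    fun x hx ↦ by rw [h0 x hx, inner_zero_left], ← Real.norm_eq_abs]
  have h1 := norm_setIntegral_le_of_norm_le_const (μ := volume)
    (f := fun x ↦ ⟪bubble s y F x, bubble t z G x⟫)
    (C := √(s ^ Module.finrank ℝ E) * A * (√(t ^ Module.finrank ℝ E) * B))
    (measure_closedBall_lt_top (x := y) (r := r / s)) fun x _ ↦ by
      refine (norm_inner_le_norm _ _).trans ?_
      simp only [bubble, norm_smul, Real.norm_of_nonneg (Real.sqrt_nonneg _)]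
      gcongr
      · exact hF _
      · exact hG _
  refine h1.trans_eq ?_
  rw [Measure.addHaar_real_closedBall' _ _ (by positivity), div_pow, div_pow,
    Real.sqrt_div (by positivity)]
  have h2 : 0 < s ^ Module.finrank ℝ E := by positivity
  have h3 := Real.sqrt_pos.2 h2
  have h4 := Real.sq_sqrt h2.le
  field_simp
  rw [h4]

lemma integral_inner_bubble_eq_zero {F G : E → E} {r : ℝ}
    (hFr : ∀ x, r < ‖x‖ → F x = 0) (hGr : ∀ x, r < ‖x‖ → G x = 0)
    {s t : ℝ} (hs : 0 < s) (ht : 0 < t) {y z : E} (h : r / s + r / t < ‖y - z‖) :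
    ∫ x, ⟪bubble s y F x, bubble t z G x⟫ = 0 := by
  refine integral_eq_zero_of_ae (ae_of_all _ fun x ↦ ?_)
  have h1 : r / s < ‖x - y‖ ∨ r / t < ‖x - z‖ := by
    by_contra! hc
    have := norm_sub_le_norm_sub_add_norm_sub y x z
    rw [norm_sub_rev y x] at this
    linarith
  rcases h1 with h1 | h1
  · have : F (s • (x - y)) = 0 := hFr _ (by
      rwa [norm_smul, Real.norm_of_nonneg hs.le, mul_comm, ← div_lt_iff₀ hs])
    simp [bubble, this]
  · have : G (t • (x - z)) = 0 := hGr _ (by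
      rwa [norm_smul, Real.norm_of_nonneg ht.le, mul_comm, ← div_lt_iff₀ ht])
    simp [bubble, this]

/-- Asymptotically decoupled bubbles are asymptotically orthogonal in `L²`. -/
lemma tendsto_integral_inner_bubble_zero (hE : 1 ≤ Module.finrank ℝ E) {F G : E → E}
    (hF : Continuous F) (hFc : HasCompactSupport F)
    (hG : Continuous G) (hGc : HasCompactSupport G) {j l : ℕ → ℕ} {y z : ℕ → E}
    (h : Tendsto (fun k ↦ |(l k : ℝ) - (j k : ℝ)| +
      ((2 : ℝ) ^ l k + (2 : ℝ) ^ j k) * ‖y k - z k‖) atTop atTop) :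
    Tendsto (fun k ↦ ∫ x, ⟪bubble (2 ^ j k) (y k) F x, bubble (2 ^ l k) (z k) G x⟫)
      atTop (𝓝 0) := by
  obtain ⟨A, hA⟩ := hFc.exists_bound_of_continuous hF
  obtain ⟨B, hB⟩ := hGc.exists_bound_of_continuous hG
  obtain ⟨r, hr0, hr⟩ : ∃ r : ℝ, 0 < r ∧ tsupport F ∪ tsupport G ⊆ Metric.closedBall 0 r := by
    obtain ⟨r, hr⟩ := (hFc.isCompact.union hGc.isCompact).isBounded.subset_closedBall (0 : E)
    exact ⟨max r 1, by positivity, hr.trans (Metric.closedBall_subset_closedBall (le_max_left _ _))⟩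
  have hFr (x : E) (hx : r < ‖x‖) : F x = 0 := by
    by_contra hc
    exact hx.not_ge (mem_closedBall_zero_iff.1 (hr (.inl (subset_tsupport _ hc))))
  have hGr (x : E) (hx : r < ‖x‖) : G x = 0 := by
    by_contra hc
    exact hx.not_ge (mem_closedBall_zero_iff.1 (hr (.inr (subset_tsupport _ hc))))
  set D := A * B * (r ^ Module.finrank ℝ E * volume.real (Metric.closedBall (0 : E) 1)) with hD
  have hD0 : 0 ≤ D := by
    have := (norm_nonneg _).trans (hA 0)
    have := (norm_nonneg _).trans (hB 0)
    positivity
  have hdecay {s t : ℝ} (hs : 0 < s) (ht : 0 < t) {L : ℕ} (hst : 2 ^ L * t ≤ s) :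
      D * √((t / s) ^ Module.finrank ℝ E) ≤ D * √((1 / 2) ^ L) := by
    have h1 : t / s ≤ (1 / 2) ^ L := by
      rw [one_div, inv_pow, div_le_iff₀ hs, ← div_eq_inv_mul, le_div_iff₀ (by positivity), mul_comm]
      exact hst
    have h2 : t / s ≤ 1 := h1.trans (pow_le_one₀ (by norm_num) (by norm_num))
    gcongr
    exact (pow_le_of_le_one (by positivity) h2 (by omega)).trans h1
  rw [Metric.tendsto_nhds]
  intro ε hε
  obtain ⟨L, hL⟩ : ∃ L : ℕ, D * √((1 / 2) ^ L) < ε := by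
    have h1 : Tendsto (fun L : ℕ ↦ D * √((1 / 2 : ℝ) ^ L)) atTop (𝓝 (D * √0)) :=
      ((Real.continuous_sqrt.tendsto 0).comp
        (tendsto_pow_atTop_nhds_zero_of_lt_one (by norm_num) (by norm_num))).const_mul D
    rw [Real.sqrt_zero, mul_zero] at h1
    exact (h1.eventually_lt_const hε).exists
  filter_upwards [h.eventually_gt_atTop (L + r * (2 + 2 * 2 ^ L))] with k hk
  rw [Real.dist_0_eq_abs]
  set s : ℝ := 2 ^ j k with hs
  set t : ℝ := 2 ^ l k with ht
  have hs0 : 0 < s := by positivity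
  have ht0 : 0 < t := by positivity
  rcases le_total (l k + L) (j k) with h1 | h1
  · refine lt_of_le_of_lt ?_ hL
    refine (abs_integral_inner_bubble_le hr0.le hA hB hFr hs0 ht0 _ _).trans (hdecay hs0 ht0 ?_)
    rw [hs, ht, ← pow_add]
    exact pow_le_pow_right₀ one_le_two (by omega)
  rcases le_total (j k + L) (l k) with h2 | h2
  · refine lt_of_le_of_lt ?_ hL
    simp only [real_inner_comm (bubble t (z k) G _)]
    refine (abs_integral_inner_bubble_le hr0.le hB hA hGr ht0 hs0 _ _).trans ?_
    rw [mul_comm B A]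
    refine hdecay ht0 hs0 ?_
    rw [hs, ht, ← pow_add]
    exact pow_le_pow_right₀ one_le_two (by omega)
  rw [integral_inner_bubble_eq_zero hFr hGr hs0 ht0, abs_zero]
  · exact hε
  have h3 : s ≤ 2 ^ L * t := by
    rw [hs, ht, ← pow_add]
    exact pow_le_pow_right₀ one_le_two (by omega)
  have h4 : t ≤ 2 ^ L * s := by
    rw [hs, ht, ← pow_add]
    exact pow_le_pow_right₀ one_le_two (by omega)
  have h5 : |(l k : ℝ) - j k| ≤ L := by
    rw [abs_le]
    have h1' : (j k : ℝ) ≤ l k + L := by exact_mod_cast h1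
    have h2' : (l k : ℝ) ≤ j k + L := by exact_mod_cast h2
    constructor <;> linarith
  have h6 : r * (2 + 2 * 2 ^ L) < (t + s) * ‖y k - z k‖ := by linarith
  have h7 : (t + s) * (r / s + r / t) ≤ r * (2 + 2 * 2 ^ L) := by
    have h8 : s / t ≤ 2 ^ L := (div_le_iff₀ ht0).2 h3
    have h9 : t / s ≤ 2 ^ L := (div_le_iff₀ hs0).2 h4
    calc (t + s) * (r / s + r / t) = r * (2 + s / t + t / s) := by field_simp; ring
      _ ≤ r * (2 + 2 * 2 ^ L) := mul_le_mul_of_nonneg_left (by linarith) hr0.le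
  exact lt_of_mul_lt_mul_left (h7.trans_lt h6) (by positivity)

end Bubble

section Plancherel

variable {E : Type*} [NormedAddCommGroup E] [InnerProductSpace ℝ E] [MeasurableSpace E]
  [BorelSpace E] [FiniteDimensional ℝ E]

lemma two_mul_sum_integral_inner_sub_le {ι : Type*} [Fintype ι] {G : E → E} (hG : Continuous G)
    (hGc : HasCompactSupport G) {B : ι → E → E} (hB : ∀ n, Continuous (B n))
    (hBc : ∀ n, HasCompactSupport (B n)) :
    2 * (∑ n, ∫ x, ⟪G x, B n x⟫) - ∑ n, ∑ m, ∫ x, ⟪B n x, B m x⟫ ≤ ∫ x, ‖G x‖ ^ 2 := by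
  have hint {f g : E → E} (hf : Continuous f) (hg : Continuous g) (hfc : HasCompactSupport f) :
      Integrable fun x ↦ ⟪f x, g x⟫ :=
    (hf.inner hg).integrable_of_hasCompactSupport (hfc.mono fun x hx h0 ↦ hx (by simp [h0]))
  have h0 (n : ι) := hint hG (hB n) hGc
  have h1 (n m : ι) := hint (hB n) (hB m) (hBc n)
  have h2 : Integrable fun x ↦ ‖G x‖ ^ 2 := by
    simpa only [real_inner_self_eq_norm_sq] using hint hG hG hGc
  have h3 : Integrable fun x ↦ 2 * ∑ n, ⟪G x, B n x⟫ :=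
    (integrable_finsetSum _ fun n _ ↦ h0 n).const_mul 2
  have h4 : Integrable fun x ↦ ∑ n, ∑ m, ⟪B n x, B m x⟫ :=
    integrable_finsetSum _ fun n _ ↦ integrable_finsetSum _ fun m _ ↦ h1 n m
  have h5 : ∫ x, (2 * ∑ n, ⟪G x, B n x⟫ - ∑ n, ∑ m, ⟪B n x, B m x⟫) ≤ ∫ x, ‖G x‖ ^ 2 := by
    refine integral_mono (h3.sub h4) h2 fun x ↦ ?_
    have h6 := sq_nonneg ‖G x - ∑ n, B n x‖
    rw [norm_sub_sq_real, ← real_inner_self_eq_norm_sq (∑ n, B n x), sum_inner] at h6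
    simp only [inner_sum] at h6
    linarith
  rw [integral_sub h3 h4, integral_const_mul, integral_finsetSum _ fun n _ ↦ h0 n,
    integral_finsetSum _ fun n _ ↦ integrable_finsetSum _ fun m _ ↦ h1 n m] at h5
  simpa only [integral_finsetSum _ fun m _ ↦ h1 _ m] using h5

lemma two_mul_integral_inner_sub {f g : E → E} (hf : MemLp f 2) (hg : MemLp g 2) :
    2 * (∫ x, ⟪f x, g x⟫) - ∫ x, ‖g x‖ ^ 2 = (∫ x, ‖f x‖ ^ 2) - ∫ x, ‖f x - g x‖ ^ 2 := by
  have h1 := hf.integrable_norm_pow two_ne_zero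
  have h2 := hg.integrable_norm_pow two_ne_zero
  have h3 := (hf.sub hg).integrable_norm_pow two_ne_zero
  simp only [Pi.sub_apply] at h3
  have h4 (x : E) : ⟪f x, g x⟫ = 2⁻¹ * (‖f x‖ ^ 2 + ‖g x‖ ^ 2 - ‖f x - g x‖ ^ 2) := by
    rw [norm_sub_sq_real]; ring
  simp only [h4]
  have h5 : Integrable fun x ↦ ‖f x‖ ^ 2 + ‖g x‖ ^ 2 := h1.add h2
  rw [integral_const_mul, integral_sub h5 h3, integral_add h1 h2]
  ring

lemma integral_inner_gradient_bubble {d : ℝ} (hd : d = Module.finrank ℝ E) {u : E → ℝ}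
    (hu : Differentiable ℝ u) (j : ℕ) (y : E) (F : E → E) :
    ∫ x, ⟪gradient u x, bubble (2 ^ j) y F x⟫ =
      ∫ ξ, ⟪gradient (fun ξ' ↦ ((2 : ℝ) ^ ((j : ℝ) * ((d - 2) / 2)))⁻¹ *
        u (y + ((2 : ℝ) ^ j)⁻¹ • ξ')) ξ, F ξ⟫ := by
  simp only [gradient_const_mul_comp_add_smul hu, real_inner_smul_left]
  rw [integral_inner_bubble _ _ (by positivity), integral_const_mul, ← mul_inv]
  congr 2
  rw [Real.sqrt_eq_rpow, ← Real.rpow_natCast _ (Module.finrank ℝ E), ← hd,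
    ← Real.rpow_natCast 2 j, ← Real.rpow_mul (by positivity), ← Real.rpow_mul (by positivity),
    ← Real.rpow_add two_pos]
  congr 1
  ring

end Plancherel

/-- the finite Plancherel-type inequality from Step 6 of the proof of
Theorem 3.3 in ℝ^N. -/
theorem struwe_solimini_stmt10 (N : ℕ) (hN : 3 ≤ N)
    (u : ℕ → EuclideanSpace ℝ (Fin N) → ℝ)
    (hsm : ∀ k, ContDiff ℝ (⊤ : ℕ∞) (u k)) (hsupp : ∀ k, HasCompactSupport (u k))
    (hbd : ∃ C : ℝ, ∀ k, (∫ x, (‖gradient (u k) x‖ ^ 2 + (u k x) ^ 2)) ≤ C)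
    (ν : ℕ) (j : Fin ν → ℕ → ℕ) (hj : ∀ n, Tendsto (j n) atTop atTop)
    (y : Fin ν → ℕ → EuclideanSpace ℝ (Fin N))
    (w : Fin ν → EuclideanSpace ℝ (Fin N) → ℝ) (hw : ∀ n, ContDiff ℝ 1 (w n))
    (hwLp : ∀ n, Integrable (fun x => |w n x| ^ ((2 * (N : ℝ)) / ((N : ℝ) - 2))))
    (hwgrad : ∀ n, Integrable (fun x => ‖gradient (w n) x‖ ^ 2))
    (hdec : ∀ n n' : Fin ν, n ≠ n' →
      Tendsto (fun k => |(j n' k : ℝ) - (j n k : ℝ)| +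
          ((2 : ℝ) ^ (j n' k) + (2 : ℝ) ^ (j n k)) * ‖y n k - y n' k‖) atTop atTop)
    (hconv : ∀ n, ∀ φ : EuclideanSpace ℝ (Fin N) → ℝ, ContDiff ℝ (⊤ : ℕ∞) φ → HasCompactSupport φ →
      Tendsto (fun k => ∫ ξ,
          ⟪gradient (fun ξ' => ((2 : ℝ) ^ ((j n k : ℝ) * (((N : ℝ) - 2) / 2)))⁻¹ *
              u k (y n k + ((2 : ℝ) ^ (j n k))⁻¹ • ξ')) ξ, gradient φ ξ⟫)
        atTop (𝓝 (∫ ξ, ⟪gradient (w n) ξ, gradient φ ξ⟫))) :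
    (∑ n : Fin ν, ∫ ξ, ‖gradient (w n) ξ‖ ^ 2) ≤
      atTop.liminf (fun k => ∫ x, ‖gradient (u k) x‖ ^ 2) := by
  have hdim : (N : ℝ) = Module.finrank ℝ (EuclideanSpace ℝ (Fin N)) := by simp
  have hN2 : (2 : ℝ) < N := by exact_mod_cast hN
  have hu1 (k : ℕ) : ContDiff ℝ 1 (u k) := (hsm k).of_le (by simp)
  have hcobdd : IsCoboundedUnder (· ≥ ·) atTop fun k ↦ ∫ x, ‖gradient (u k) x‖ ^ 2 := by
    obtain ⟨C, hC⟩ := hbd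
    refine (isBoundedUnder_of ⟨C, fun k ↦ ?_⟩ : IsBoundedUnder (· ≤ ·) atTop _).isCoboundedUnder_ge
    have h1 : Integrable fun x ↦ ‖gradient (u k) x‖ ^ 2 :=
      ((hu1 k).continuous_gradient.memLp_of_hasCompactSupport
        (hsupp k).gradient).integrable_norm_pow two_ne_zero
    have h2 : Integrable fun x ↦ (u k x) ^ 2 :=
      ((hsm k).continuous.memLp_of_hasCompactSupport (hsupp k) (p := 2)).integrable_sq
    refine le_trans (integral_mono h1 (h1.add h2) fun x ↦ ?_) (hC k)
    exact le_add_of_nonneg_right (sq_nonneg _)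
  refine le_of_forall_pos_lt_add fun ε hε ↦ ?_
  have hδ : 0 < ε / (2 * (ν + 1)) := by positivity
  choose φ hφ hφc hφε using fun n ↦ exists_contDiff_integral_norm_gradient_sub_sq_le hdim hN2
    (hw n) (hwLp n) (hwgrad n) hδ
  have hφ1 (n) : Continuous (gradient (φ n)) := ((hφ n).of_le (by simp)).continuous_gradient
  set b : ℕ → Fin ν → EuclideanSpace ℝ (Fin N) → EuclideanSpace ℝ (Fin N) :=
    fun k n ↦ bubble (2 ^ j n k) (y n k) (gradient (φ n)) with hb
  have hlower (k : ℕ) := two_mul_sum_integral_inner_sub_le (hu1 k).continuous_gradient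
    (hsupp k).gradient (B := b k) (fun n ↦ (hφ1 n).bubble _ _)
    fun n ↦ (hφc n).gradient.bubble (by positivity) _
  have hlin (n : Fin ν) : Tendsto (fun k ↦ ∫ x, ⟪gradient (u k) x, b k n x⟫) atTop
      (𝓝 (∫ ξ, ⟪gradient (w n) ξ, gradient (φ n) ξ⟫)) :=
    (hconv n (φ n) (hφ n) (hφc n)).congr fun k ↦ (integral_inner_gradient_bubble hdim
      ((hu1 k).differentiable one_ne_zero) _ _ _).symm
  have hquad (n m : Fin ν) : Tendsto (fun k ↦ ∫ x, ⟪b k n x, b k m x⟫) atTop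
      (𝓝 (if n = m then ∫ ξ, ‖gradient (φ n) ξ‖ ^ 2 else 0)) := by
    split_ifs with hnm
    · subst hnm
      refine tendsto_const_nhds.congr fun k ↦ ?_
      simp only [real_inner_self_eq_norm_sq]
      exact (integral_norm_bubble_sq _ (by positivity) _).symm
    · exact tendsto_integral_inner_bubble_zero (by simp; omega) (hφ1 n) (hφc n).gradient (hφ1 m)
        (hφc m).gradient (hdec n m hnm)
  have hlim := ((tendsto_finsetSum Finset.univ fun n _ ↦ hlin n).const_mul 2).sub
    (tendsto_finsetSum Finset.univ fun n _ ↦ tendsto_finsetSum Finset.univ fun m _ ↦ hquad n m)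
  simp only [Finset.sum_ite_eq, Finset.mem_univ, if_true, Finset.mul_sum] at hlim hlower
  rw [← Finset.sum_sub_distrib] at hlim
  have hval : (∑ n, ∫ ξ, ‖gradient (w n) ξ‖ ^ 2) - ε / 2 <
      ∑ n, (2 * (∫ ξ, ⟪gradient (w n) ξ, gradient (φ n) ξ⟫) -
        ∫ ξ, ‖gradient (φ n) ξ‖ ^ 2) := by
    have h1 (n : Fin ν) := two_mul_integral_inner_sub
      ((memLp_two_iff_integrable_sq_norm (hw n).continuous_gradient.aestronglyMeasurable).2
        (hwgrad n)) ((hφ1 n).memLp_of_hasCompactSupport (hφc n).gradient)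
    have h2 := Finset.sum_le_card_nsmul Finset.univ _ _ fun n _ ↦ hφε n
    have h3 : (ν : ℝ) * (ε / (2 * (ν + 1))) < ε / 2 := by
      rw [← mul_div_assoc, div_lt_div_iff₀ (by positivity) two_pos]
      nlinarith
    rw [Finset.card_univ, Fintype.card_fin, nsmul_eq_mul] at h2
    simp only [h1, Finset.sum_sub_distrib]
    linarith
  have hev := hlim.eventually_const_lt hval
  have := le_liminf_of_le hcobdd (hev.mono fun k hk ↦ (hk.trans_le (hlower k)).le)
  linarith
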